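/- For every n ≥ 1, the covariance of the numbers of occurrences of the patterns 123 and 321 in a uniformly random permutation of S_n satisfies (1/n!)·∑_{π ∈ S_n} (N_{123}(π) − binom(n,3)/6)(N_{321}(π) − binom(n,3)/6) = −n(n−1)(n−2)(9n² + 12n − 92)/5400. -/

import Mathlib

/-- The number of occurrences of the pattern `σ ∈ S_k` in the permutation `π ∈ S_n`. -/
def occ {k n : ℕ} (σ : Equiv.Perm (Fin k)) (π : Equiv.Perm (Fin n)) : ℕ :=
  (Finset.univ.filter (fun f : Fin k → Fin n =>
    (∀ a b : Fin k, a < b → f a < f b) ∧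
    (∀ a b : Fin k, π (f a) < π (f b) ↔ σ a < σ b))).card

/-- The pattern 123 (one-line notation), i.e. the identity of `S_3`. -/
def p123 : Equiv.Perm (Fin 3) := 1

/-- The pattern 132 (one-line notation). -/
def p132 : Equiv.Perm (Fin 3) := Equiv.swap 1 2

/-- The pattern 312 (one-line notation): 1 ↦ 3, 2 ↦ 1, 3 ↦ 2. -/
def p312 : Equiv.Perm (Fin 3) := ⟨![2, 0, 1], ![1, 2, 0], by decide, by decide⟩

/-- The pattern 321 (one-line notation). -/
def p321 : Equiv.Perm (Fin 3) := Equiv.swap 0 2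

open Finset Equiv

section PatternPairs

instance decidableStrictMonoOnFinset {n m : ℕ} (x : Fin n → Fin m) (A : Finset (Fin n)) :
    Decidable (StrictMonoOn x (A : Set (Fin n))) :=
  decidable_of_iff (∀ a ∈ A, ∀ b ∈ A, a < b → x a < x b)
    ⟨fun h a ha b hb => h a ha b hb, fun h _ ha _ hb => h ha hb⟩

instance decidableStrictAntiOnFinset {n m : ℕ} (x : Fin n → Fin m) (A : Finset (Fin n)) :
    Decidable (StrictAntiOn x (A : Set (Fin n))) :=
  decidable_of_iff (∀ a ∈ A, ∀ b ∈ A, a < b → x b < x a)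
    ⟨fun h a ha b hb => h a ha b hb, fun h _ ha _ hb => h ha hb⟩

/-- Counting strictly monotone maps out of `Fin k` is the same as counting their images. -/
lemma card_filter_strictMono {k n : ℕ} (P : (Fin k → Fin n) → Prop) (Q : Finset (Fin n) → Prop)
    [DecidablePred P] [DecidablePred Q]
    (h : ∀ f, StrictMono f → (P f ↔ Q (univ.image f))) :
    #{f : Fin k → Fin n | (∀ a b : Fin k, a < b → f a < f b) ∧ P f}
      = #{A ∈ powersetCard k (univ : Finset (Fin n)) | Q A} := by
  refine card_bij (fun f _ => univ.image f) ?_ ?_ ?_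
  · intro f hf
    obtain ⟨hm, hP⟩ := (mem_filter.1 hf).2
    have hm : StrictMono f := fun a b => hm a b
    refine mem_filter.2 ⟨mem_powersetCard.2 ⟨subset_univ _, ?_⟩, (h f hm).1 hP⟩
    rw [card_image_of_injective _ hm.injective, card_univ, Fintype.card_fin]
  · intro f hf f' hf' hff
    have hm : StrictMono f := fun a b => (mem_filter.1 hf).2.1 a b
    have hm' : StrictMono f' := fun a b => (mem_filter.1 hf').2.1 a b
    have hc : (univ.image f).card = k := by
      rw [card_image_of_injective _ hm.injective, card_univ, Fintype.card_fin]
    exact (orderEmbOfFin_unique hc (fun x => mem_image_of_mem f (mem_univ x)) hm).trans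
      (orderEmbOfFin_unique hc (fun x => hff ▸ mem_image_of_mem f' (mem_univ x)) hm').symm
  · intro A hA
    obtain ⟨hA, hQ⟩ := mem_filter.1 hA
    have hc := (mem_powersetCard.1 hA).2
    have hm : StrictMono (A.orderEmbOfFin hc) := (A.orderEmbOfFin hc).strictMono
    have hi : univ.image (A.orderEmbOfFin hc) = A := image_orderEmbOfFin_univ A hc
    refine ⟨A.orderEmbOfFin hc, ?_, hi⟩
    exact mem_filter.2 ⟨mem_univ _, fun a b => @hm a b, (h _ hm).2 (hi.symm ▸ hQ)⟩

lemma occ_p123 {n : ℕ} (π : Perm (Fin n)) :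
    occ p123 π = #((powersetCard 3 univ).filter fun A : Finset (Fin n) =>
      StrictMonoOn π (A : Set (Fin n))) := by
  refine card_filter_strictMono _ _ fun f hf => ?_
  simp only [p123, Perm.one_apply, coe_image, coe_univ, Set.image_univ]
  constructor
  · rintro h _ ⟨a, rfl⟩ _ ⟨b, rfl⟩ hab
    exact (h a b).2 (hf.lt_iff_lt.1 hab)
  · intro h a b
    rw [h.lt_iff_lt ⟨a, rfl⟩ ⟨b, rfl⟩, hf.lt_iff_lt]

lemma occ_p321 {n : ℕ} (π : Perm (Fin n)) :
    occ p321 π = #((powersetCard 3 univ).filter fun A : Finset (Fin n) =>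
      StrictAntiOn π (A : Set (Fin n))) := by
  refine card_filter_strictMono _ _ fun f hf => ?_
  have hp : ∀ a b : Fin 3, p321 a < p321 b ↔ b < a := by decide
  simp only [hp, coe_image, coe_univ, Set.image_univ]
  constructor
  · rintro h _ ⟨a, rfl⟩ _ ⟨b, rfl⟩ hab
    exact (h b a).2 (hf.lt_iff_lt.1 hab)
  · intro h a b
    rw [h.lt_iff_gt ⟨a, rfl⟩ ⟨b, rfl⟩, hf.lt_iff_lt]

/-- Averaging over the relative order of the values at the positions in the range of `e`. -/
lemma factorial_mul_sum_comp_mul {k n : ℕ} (e : Fin k ↪ Fin n) (g : (Fin k → Fin n) → ℚ)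
    (g' : Perm (Fin k) → ℚ) (ψ : Perm (Fin n) → ℚ)
    (hg : ∀ i : Fin k → Fin n, StrictMono i → ∀ σ : Perm (Fin k), g (i ∘ σ) = g' σ)
    (hψ : ∀ (π : Perm (Fin n)) (τ : Perm (Fin k)), ψ (π * τ.viaFintypeEmbedding e) = ψ π) :
    (k.factorial : ℚ) * ∑ π : Perm (Fin n), g (π ∘ e) * ψ π
      = (∑ σ : Perm (Fin k), g' σ) * ∑ π : Perm (Fin n), ψ π := by
  have hτ (τ : Perm (Fin k)) :
      ∑ π : Perm (Fin n), g (π ∘ e) * ψ π = ∑ π : Perm (Fin n), g (π ∘ e ∘ τ) * ψ π := by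
    rw [← Equiv.sum_comp (Equiv.mulRight (τ.viaFintypeEmbedding e))]
    refine sum_congr rfl fun π _ => ?_
    rw [Equiv.coe_mulRight, hψ]
    congr 2
    ext a
    simp [Perm.viaFintypeEmbedding_apply_image]
  have hπ (π : Perm (Fin n)) : ∑ τ : Perm (Fin k), g (π ∘ e ∘ τ) = ∑ σ : Perm (Fin k), g' σ := by
    let x : Fin k → Fin n := π ∘ e
    have hx : Function.Injective x := π.injective.comp e.injective
    have hm : StrictMono (x ∘ Tuple.sort x) :=
      (Tuple.monotone_sort x).strictMono_of_injective (hx.comp (Tuple.sort x).injective)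
    rw [← Equiv.sum_comp (Equiv.mulLeft (Tuple.sort x))]
    exact sum_congr rfl fun τ _ => hg _ hm τ
  calc (k.factorial : ℚ) * ∑ π : Perm (Fin n), g (π ∘ e) * ψ π
      = ∑ _τ : Perm (Fin k), ∑ π : Perm (Fin n), g (π ∘ e) * ψ π := by
        simp [Fintype.card_perm]
    _ = ∑ τ : Perm (Fin k), ∑ π : Perm (Fin n), g (π ∘ e ∘ τ) * ψ π :=
        sum_congr rfl fun τ _ => hτ τ
    _ = _ := by
        rw [sum_comm, mul_sum]
        exact sum_congr rfl fun π _ => by rw [← sum_mul, hπ]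

/-- The indicator that `x` is increasing on `A` and decreasing on `B`. -/
def incDecInd {k n : ℕ} (A B : Finset (Fin k)) (x : Fin k → Fin n) : ℚ :=
  if StrictMonoOn x (A : Set (Fin k)) ∧ StrictAntiOn x (B : Set (Fin k)) then 1 else 0

/-- The probability that a random permutation is increasing on `A` and decreasing on `B`. -/
def incDecProb {n : ℕ} (A B : Finset (Fin n)) : ℚ :=
  (∑ π : Perm (Fin n), incDecInd A B π) / n.factorial

lemma sum_incDecInd {n : ℕ} (A B : Finset (Fin n)) :
    ∑ π : Perm (Fin n), incDecInd A B π = (#{π : Perm (Fin n) |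
      StrictMonoOn π (A : Set (Fin n)) ∧ StrictAntiOn π (B : Set (Fin n))} : ℚ) := by
  simp only [incDecInd, sum_boole]

lemma incDecInd_strictMono_comp {k n m : ℕ} (A B : Finset (Fin k)) {i : Fin m → Fin n}
    (hi : StrictMono i) (x : Fin k → Fin m) : incDecInd A B (i ∘ x) = incDecInd A B x := by
  unfold incDecInd
  congr 1
  simp only [StrictMonoOn, StrictAntiOn, Function.comp_apply, hi.lt_iff_lt]

lemma incDecInd_map {k n m : ℕ} (e : Fin k ↪o Fin n) (A B : Finset (Fin k)) (x : Fin n → Fin m) :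
    incDecInd (A.map e.toEmbedding) (B.map e.toEmbedding) x = incDecInd A B (x ∘ e) := by
  simp [incDecInd, StrictMonoOn, StrictAntiOn]

lemma incDecInd_eq_mul {k n : ℕ} (A B : Finset (Fin k)) (x : Fin k → Fin n) :
    incDecInd A B x = incDecInd A ∅ x * incDecInd ∅ B x := by
  have hm : StrictMonoOn x (∅ : Set (Fin k)) := Set.subsingleton_empty.strictMonoOn x
  have ha : StrictAntiOn x (∅ : Set (Fin k)) := Set.subsingleton_empty.strictAntiOn x
  by_cases hA : StrictMonoOn x (A : Set (Fin k)) <;>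
    by_cases hB : StrictAntiOn x (B : Set (Fin k)) <;> simp [incDecInd, hA, hB, hm, ha]

lemma incDecProb_map {k n : ℕ} (e : Fin k ↪o Fin n) (A B : Finset (Fin k)) :
    incDecProb (A.map e.toEmbedding) (B.map e.toEmbedding) = incDecProb A B := by
  have h := factorial_mul_sum_comp_mul e.toEmbedding (incDecInd A B) (fun σ => incDecInd A B σ)
    (fun _ => 1) (fun i hi σ => incDecInd_strictMono_comp A B hi σ) (fun _ _ => rfl)
  simp only [mul_one, sum_const, card_univ, Fintype.card_perm, Fintype.card_fin, nsmul_eq_mul] at h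
  have hk : (k.factorial : ℚ) ≠ 0 := by positivity
  have hn : (n.factorial : ℚ) ≠ 0 := by positivity
  rw [incDecProb, incDecProb, div_eq_div_iff hn hk, mul_comm, ← h]
  simp only [incDecInd_map]
  rfl

lemma map_orderEmbOfFin_toEmbedding {n k : ℕ} {S : Finset (Fin n)} (hS : S.card = k) :
    univ.map (S.orderEmbOfFin hS).toEmbedding = S :=
  map_orderEmbOfFin_univ S hS

lemma sum_incDecInd_univ_empty : ∑ σ : Perm (Fin 3), incDecInd univ ∅ σ = 1 := by
  have hc : #{σ : Perm (Fin 3) | StrictMonoOn σ ((univ : Finset (Fin 3)) : Set (Fin 3)) ∧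
      StrictAntiOn σ ((∅ : Finset (Fin 3)) : Set (Fin 3))} = 1 := by decide +kernel
  rw [sum_incDecInd, hc, Nat.cast_one]

lemma incDecProb_left {n : ℕ} {A : Finset (Fin n)} (hA : A.card = 3) :
    incDecProb A ∅ = 1 / 6 := by
  have h3 : incDecProb (univ : Finset (Fin 3)) ∅ = 1 / 6 := by
    rw [incDecProb, sum_incDecInd_univ_empty]
    norm_num [Nat.factorial]
  rw [← h3, ← incDecProb_map (A.orderEmbOfFin hA), map_orderEmbOfFin_toEmbedding, map_empty]

lemma incDecProb_right {n : ℕ} {B : Finset (Fin n)} (hB : B.card = 3) :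
    incDecProb ∅ B = 1 / 6 := by
  have hc : #{σ : Perm (Fin 3) | StrictMonoOn σ ((∅ : Finset (Fin 3)) : Set (Fin 3)) ∧
      StrictAntiOn σ ((univ : Finset (Fin 3)) : Set (Fin 3))} = 1 := by decide +kernel
  have h3 : incDecProb ∅ (univ : Finset (Fin 3)) = 1 / 6 := by
    rw [incDecProb, sum_incDecInd, hc]
    norm_num [Nat.factorial]
  rw [← h3, ← incDecProb_map (B.orderEmbOfFin hB), map_orderEmbOfFin_toEmbedding, map_empty]

lemma incDecProb_of_disjoint {n : ℕ} {A B : Finset (Fin n)} (hA : A.card = 3) (hB : B.card = 3)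
    (hAB : Disjoint A B) : incDecProb A B = 1 / 36 := by
  let e := A.orderEmbOfFin hA
  have hinv (π : Perm (Fin n)) (τ : Perm (Fin 3)) :
      incDecInd ∅ B (π * τ.viaFintypeEmbedding e.toEmbedding) = incDecInd ∅ B π := by
    have hfix (b : Fin n) (hb : b ∈ B) : τ.viaFintypeEmbedding e.toEmbedding b = b := by
      refine Perm.viaFintypeEmbedding_apply_notMem_range _ _ fun hr => ?_
      have hbA : b ∈ (A : Set (Fin n)) := by
        rw [← range_orderEmbOfFin A hA]
        exact hr
      exact disjoint_left.1 hAB hbA hb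
    have heq : Set.EqOn (π * τ.viaFintypeEmbedding e.toEmbedding) π (B : Set (Fin n)) :=
      fun b hb => by rw [Perm.mul_apply, hfix b hb]
    simp only [incDecInd, heq.congr_strictAntiOn, coe_empty,
      Set.subsingleton_empty.strictMonoOn, true_and]
  have h := factorial_mul_sum_comp_mul e.toEmbedding (incDecInd univ ∅)
    (fun σ => incDecInd univ ∅ σ) (fun π => incDecInd ∅ B π)
    (fun i hi σ => incDecInd_strictMono_comp univ ∅ hi σ) hinv
  have hsplit (π : Perm (Fin n)) :
      incDecInd univ ∅ (π ∘ e.toEmbedding) * incDecInd ∅ B π = incDecInd A B π := by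
    rw [incDecInd_eq_mul A B, ← map_orderEmbOfFin_toEmbedding hA, ← map_empty e.toEmbedding,
      incDecInd_map, map_empty]
    rfl
  have hr := incDecProb_right hB
  simp only [hsplit, sum_incDecInd_univ_empty, one_mul] at h
  rw [incDecProb] at hr ⊢
  have hn : (n.factorial : ℚ) ≠ 0 := by positivity
  rw [div_eq_iff hn] at hr ⊢
  rw [hr] at h
  norm_num [Nat.factorial] at h
  linarith

/-- The ordered pairs of triples covering `S`. -/
def triplePairsCovering {n : ℕ} (S : Finset (Fin n)) : Finset (Finset (Fin n) × Finset (Fin n)) :=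
  {p ∈ powersetCard 3 univ ×ˢ powersetCard 3 univ | p.1 ∪ p.2 = S}

lemma mem_triplePairsCovering {n : ℕ} {S : Finset (Fin n)}
    {p : Finset (Fin n) × Finset (Fin n)} :
    p ∈ triplePairsCovering S ↔ (p.1.card = 3 ∧ p.2.card = 3) ∧ p.1 ∪ p.2 = S := by
  simp [triplePairsCovering, mem_powersetCard]

/-- The sum of `incDecProb` over the pairs of triples covering `Fin k`. -/
def coverSum (k : ℕ) : ℚ := ∑ p ∈ triplePairsCovering (univ : Finset (Fin k)), incDecProb p.1 p.2

lemma sum_triplePairsCovering {n : ℕ} (S : Finset (Fin n)) :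
    ∑ p ∈ triplePairsCovering S, incDecProb p.1 p.2 = coverSum S.card := by
  let e := S.orderEmbOfFin rfl
  have he : univ.map e.toEmbedding = S := map_orderEmbOfFin_toEmbedding rfl
  symm
  refine sum_bij (fun p _ => (p.1.map e.toEmbedding, p.2.map e.toEmbedding)) ?_ ?_ ?_ ?_
  · intro p hp
    rw [mem_triplePairsCovering] at hp ⊢
    simp only [card_map, ← map_union, hp, he, and_self]
  · intro p _ q _ hpq
    simpa [Prod.ext_iff] using hpq
  · intro p hp
    rw [mem_triplePairsCovering] at hp
    obtain ⟨A, -, hA⟩ := subset_map_iff.1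
      (he.symm ▸ hp.2 ▸ subset_union_left : p.1 ⊆ univ.map e.toEmbedding)
    obtain ⟨B, -, hB⟩ := subset_map_iff.1
      (he.symm ▸ hp.2 ▸ subset_union_right : p.2 ⊆ univ.map e.toEmbedding)
    refine ⟨(A, B), ?_, by simp [← hA, ← hB]⟩
    rw [hA, hB, card_map, card_map, ← map_union] at hp
    rw [mem_triplePairsCovering]
    exact ⟨hp.1, map_injective e.toEmbedding (hp.2.trans he.symm)⟩
  · intro p _
    exact (incDecProb_map e p.1 p.2).symm

lemma coverSum_of_lt {k : ℕ} (hk : 6 < k) : coverSum k = 0 := by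
  refine sum_eq_zero fun p hp => ?_
  rw [mem_triplePairsCovering] at hp
  have h := card_union_le p.1 p.2
  rw [hp.2, hp.1.1, hp.1.2, card_univ, Fintype.card_fin] at h
  omega

lemma coverSum_six : coverSum 6 = 20 / 36 := by
  have hc : (triplePairsCovering (univ : Finset (Fin 6))).card = 20 := by decide +kernel
  have h (p) (hp : p ∈ triplePairsCovering (univ : Finset (Fin 6))) :
      incDecProb p.1 p.2 = 1 / 36 := by
    rw [mem_triplePairsCovering] at hp
    refine incDecProb_of_disjoint hp.1.1 hp.1.2 ?_
    rw [← card_union_eq_card_add_card, hp.1.1, hp.1.2, hp.2, card_univ, Fintype.card_fin]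
  rw [coverSum, sum_congr rfl h, sum_const, hc]
  norm_num

/-- The sum over all permutations of the product of the numbers of increasing and decreasing
triples. -/
def tripleTotal (n : ℕ) : ℕ := ∑ π : Perm (Fin n),
  #((powersetCard 3 univ).filter fun A : Finset (Fin n) =>
      StrictMonoOn π (A : Set (Fin n))) *
  #((powersetCard 3 univ).filter fun B : Finset (Fin n) =>
      StrictAntiOn π (B : Set (Fin n)))

lemma card_strictMonoOn {n : ℕ} (π : Perm (Fin n)) :
    (#((powersetCard 3 univ).filter fun A : Finset (Fin n) =>
      StrictMonoOn π (A : Set (Fin n))) : ℚ)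
      = ∑ A ∈ powersetCard 3 univ, incDecInd A ∅ π := by
  rw [card_filter, Nat.cast_sum]
  exact sum_congr rfl fun A _ => by
    simp [incDecInd, Set.subsingleton_empty.strictAntiOn]

lemma card_strictAntiOn {n : ℕ} (π : Perm (Fin n)) :
    (#((powersetCard 3 univ).filter fun B : Finset (Fin n) =>
      StrictAntiOn π (B : Set (Fin n))) : ℚ)
      = ∑ B ∈ powersetCard 3 univ, incDecInd ∅ B π := by
  rw [card_filter, Nat.cast_sum]
  exact sum_congr rfl fun B _ => by
    simp [incDecInd, Set.subsingleton_empty.strictMonoOn]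

lemma tripleTotal_div_factorial (n : ℕ) :
    (tripleTotal n : ℚ) / n.factorial = ∑ k ∈ range 7, (n.choose k : ℚ) * coverSum k := by
  have hpairs : (tripleTotal n : ℚ) / n.factorial
      = ∑ p ∈ powersetCard 3 univ ×ˢ powersetCard 3 univ,
        incDecProb (n := n) p.1 p.2 := by
    simp only [tripleTotal, Nat.cast_sum, Nat.cast_mul, card_strictMonoOn, card_strictAntiOn,
      incDecProb, ← sum_div, sum_mul_sum, ← incDecInd_eq_mul]
    rw [sum_comm]
    simp only [sum_product, fun A : Finset (Fin n) => sum_comm (s := univ)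
      (t := powersetCard 3 univ) (f := fun (π : Perm (Fin n)) B => incDecInd A B π)]
  have hchoose : (tripleTotal n : ℚ) / n.factorial
      = ∑ k ∈ range (n + 1), (n.choose k : ℚ) * coverSum k := by
    rw [hpairs, ← sum_fiberwise _ (fun p => p.1 ∪ p.2), ← powerset_univ]
    have h := sum_powerset_apply_card coverSum (x := (univ : Finset (Fin n)))
    rw [card_univ, Fintype.card_fin] at h
    simp only [nsmul_eq_mul] at h
    rw [← h]
    exact sum_congr rfl fun S _ => sum_triplePairsCovering S
  rw [hchoose, sum_subset (range_mono (Nat.le_max_left (n + 1) 7)),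
    sum_subset (range_mono (Nat.le_max_right (n + 1) 7))]
  · intro k _ hk
    rw [coverSum_of_lt (not_lt.1 (mem_range.not.1 hk)), mul_zero]
  · intro k _ hk
    rw [Nat.choose_eq_zero_of_lt (by simpa using hk), Nat.cast_zero, zero_mul]

lemma tripleTotal_eq (n : ℕ) :
    (tripleTotal n : ℚ) / n.factorial
      = (n.choose 5 : ℚ) * (76 / 120) + (n.choose 6 : ℚ) * (20 / 36) := by
  have t0 : tripleTotal 0 = 0 := by decide +kernel
  have t1 : tripleTotal 1 = 0 := by decide +kernel
  have t2 : tripleTotal 2 = 0 := by decide +kernel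
  have t3 : tripleTotal 3 = 0 := by decide +kernel
  have t4 : tripleTotal 4 = 0 := by decide +kernel
  have t5 : tripleTotal 5 = 76 := by decide +kernel
  have h0 := tripleTotal_div_factorial 0
  have h1 := tripleTotal_div_factorial 1
  have h2 := tripleTotal_div_factorial 2
  have h3 := tripleTotal_div_factorial 3
  have h4 := tripleTotal_div_factorial 4
  have h5 := tripleTotal_div_factorial 5
  simp only [t0, t1, t2, t3, t4, t5, sum_range_succ, range_zero, sum_empty] at h0 h1 h2 h3 h4 h5
  norm_num [Nat.choose, Nat.factorial] at h0 h1 h2 h3 h4 h5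
  have e0 : coverSum 0 = 0 := by linarith
  have e1 : coverSum 1 = 0 := by linarith
  have e2 : coverSum 2 = 0 := by linarith
  have e3 : coverSum 3 = 0 := by linarith
  have e4 : coverSum 4 = 0 := by linarith
  have e5 : coverSum 5 = 76 / 120 := by linarith
  rw [tripleTotal_div_factorial]
  simp only [sum_range_succ, range_zero, sum_empty, e0, e1, e2, e3, e4, e5, coverSum_six]
  ring

lemma sum_occ_p123 (n : ℕ) :
    ∑ π : Perm (Fin n), (occ p123 π : ℚ) = n.factorial * ((n.choose 3 : ℚ) / 6) := by
  have hn : (n.factorial : ℚ) ≠ 0 := by positivity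
  have h (A) (hA : A ∈ powersetCard 3 (univ : Finset (Fin n))) :
      ∑ π : Perm (Fin n), incDecInd A ∅ π = n.factorial / 6 := by
    have := incDecProb_left (mem_powersetCard.1 hA).2
    rw [incDecProb, div_eq_iff hn] at this
    rw [this]
    ring
  simp only [occ_p123, card_strictMonoOn]
  rw [sum_comm, sum_congr rfl h, sum_const, card_powersetCard, card_univ, Fintype.card_fin,
    nsmul_eq_mul]
  ring

lemma sum_occ_p321 (n : ℕ) :
    ∑ π : Perm (Fin n), (occ p321 π : ℚ) = n.factorial * ((n.choose 3 : ℚ) / 6) := by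
  have hn : (n.factorial : ℚ) ≠ 0 := by positivity
  have h (B) (hB : B ∈ powersetCard 3 (univ : Finset (Fin n))) :
      ∑ π : Perm (Fin n), incDecInd ∅ B π = n.factorial / 6 := by
    have := incDecProb_right (mem_powersetCard.1 hB).2
    rw [incDecProb, div_eq_iff hn] at this
    rw [this]
    ring
  simp only [occ_p321, card_strictAntiOn]
  rw [sum_comm, sum_congr rfl h, sum_const, card_powersetCard, card_univ, Fintype.card_fin,
    nsmul_eq_mul]
  ring

lemma sum_occ_mul_occ (n : ℕ) :
    ∑ π : Perm (Fin n), (occ p123 π : ℚ) * occ p321 π = n.factorial *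
      ((n.choose 5 : ℚ) * (76 / 120) + (n.choose 6 : ℚ) * (20 / 36)) := by
  have hn : (n.factorial : ℚ) ≠ 0 := by positivity
  rw [← tripleTotal_eq, mul_div_cancel₀ _ hn]
  simp only [occ_p123, occ_p321, tripleTotal, Nat.cast_sum, Nat.cast_mul]

lemma cast_choose_succ (n k : ℕ) :
    (n.choose (k + 1) : ℚ) = n.choose k * (n - k) / (k + 1) := by
  rw [eq_div_iff (by positivity)]
  rcases le_or_gt k n with hk | hk
  · rw [← Nat.cast_sub hk]
    exact_mod_cast Nat.choose_succ_right_eq n k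
  · simp [Nat.choose_eq_zero_of_lt hk, Nat.choose_eq_zero_of_lt (hk.trans k.lt_succ_self)]

end PatternPairs

theorem stmt7 (n : ℕ) (hn : 1 ≤ n) :
    (1 / (n.factorial : ℚ)) * ∑ π : Equiv.Perm (Fin n),
        ((occ p123 π : ℚ) - (n.choose 3 : ℚ) / 6)
          * ((occ p321 π : ℚ) - (n.choose 3 : ℚ) / 6)
      = -((n : ℚ) * ((n : ℚ) - 1) * ((n : ℚ) - 2)
        * (9 * (n : ℚ) ^ 2 + 12 * (n : ℚ) - 92) / 5400) := by
  have hf : (n.factorial : ℚ) ≠ 0 := by positivity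
  have hexp : ∑ π : Equiv.Perm (Fin n), ((occ p123 π : ℚ) - (n.choose 3 : ℚ) / 6)
        * ((occ p321 π : ℚ) - (n.choose 3 : ℚ) / 6)
      = n.factorial * ((n.choose 5 : ℚ) * (76 / 120) + (n.choose 6 : ℚ) * (20 / 36)
        - ((n.choose 3 : ℚ) / 6) ^ 2) := by
    simp only [sub_mul, mul_sub, sum_sub_distrib, ← sum_mul, ← mul_sum, sum_occ_mul_occ,
      sum_occ_p123, sum_occ_p321, sum_const, card_univ, Fintype.card_perm, Fintype.card_fin,
      nsmul_eq_mul]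
    ring
  rw [hexp, ← mul_assoc, one_div, inv_mul_cancel₀ hf, one_mul]
  simp only [cast_choose_succ, Nat.choose_zero_right]
  push_cast
  ring
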